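/- Let T > 0, let F : ℝ → ℝ be smooth, and let η : ℝ×ℝ → ℝ (η = η(x,t)) be smooth. Suppose that for every test function ψ on ℝ×(0,T), ∫₀^T ∫_ℝ { (η + F(x))·(ψ_t + η ψ_x − ψ η_x) + η_x·(ψ_tx + η ψ_xx − ψ η_xx) } dx dt = 0. Then η satisfies the generalized Camassa–Holm equation F′(x)·η + η_t + (3η + 2F(x))·η_x − η_txx = 2 η_x η_xx + η η_xxx at every point of ℝ×(0,T). (This is the precise weak form of the paper's Theorem 4: for an arbitrary unidirectional shallow water flow, the displacement of the free surface from the flat state satisfies a generalized Camassa–Holm equation.) -/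

import Mathlib

open MeasureTheory Set

/-- Partial derivative in the first (spatial) variable `x` of `u = u(x,t)`. -/
noncomputable def pdx (u : ℝ × ℝ → ℝ) : ℝ × ℝ → ℝ :=
  fun p => deriv (fun x => u (x, p.2)) p.1

/-- Partial derivative in the second (time) variable `t` of `u = u(x,t)`. -/
noncomputable def pdt (u : ℝ × ℝ → ℝ) : ℝ × ℝ → ℝ :=
  fun p => deriv (fun t => u (p.1, t)) p.2

/-- A test function on `ℝ × (0,T)`: smooth, compactly supported, with support
contained in `ℝ × (0,T)`. -/
def IsTestFun (T : ℝ) (ψ : ℝ × ℝ → ℝ) : Prop :=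
  ContDiff ℝ (⊤ : ℕ∞) ψ ∧ HasCompactSupport ψ ∧ tsupport ψ ⊆ univ ×ˢ Ioo 0 T


open scoped ContDiff

lemma pdx_eq_fderiv {u : ℝ × ℝ → ℝ} (hu : ContDiff ℝ ∞ u) :
    pdx u = fun p => fderiv ℝ u p (1, 0) := by
  funext p
  have h := (hu.differentiable (by simp) p).hasFDerivAt
  exact (h.comp_hasDerivAt (f := fun x => (x, p.2)) p.1
    ((hasDerivAt_id p.1).prodMk (hasDerivAt_const p.1 p.2))).deriv

lemma pdt_eq_fderiv {u : ℝ × ℝ → ℝ} (hu : ContDiff ℝ ∞ u) :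
    pdt u = fun p => fderiv ℝ u p (0, 1) := by
  funext p
  have h := (hu.differentiable (by simp) p).hasFDerivAt
  exact (h.comp_hasDerivAt (f := fun t => (p.1, t)) p.2
    ((hasDerivAt_const p.2 p.1).prodMk (hasDerivAt_id p.2))).deriv

lemma ContDiff.pdx {u : ℝ × ℝ → ℝ} (hu : ContDiff ℝ ∞ u) : ContDiff ℝ ∞ (pdx u) := by
  rw [pdx_eq_fderiv hu]
  exact (hu.fderiv_right (by simp)).clm_apply contDiff_const

lemma ContDiff.pdt {u : ℝ × ℝ → ℝ} (hu : ContDiff ℝ ∞ u) : ContDiff ℝ ∞ (pdt u) := by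
  rw [pdt_eq_fderiv hu]
  exact (hu.fderiv_right (by simp)).clm_apply contDiff_const

lemma ContDiff.hasDerivAt_pdx {u : ℝ × ℝ → ℝ} (hu : ContDiff ℝ ∞ u) (p : ℝ × ℝ) :
    HasDerivAt (fun x => u (x, p.2)) (_root_.pdx u p) p.1 := by
  have h : ContDiff ℝ ∞ (fun x => u (x, p.2)) := by fun_prop
  exact (h.differentiable (by simp) p.1).hasDerivAt

lemma ContDiff.hasDerivAt_pdt {u : ℝ × ℝ → ℝ} (hu : ContDiff ℝ ∞ u) (p : ℝ × ℝ) :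
    HasDerivAt (fun t => u (p.1, t)) (_root_.pdt u p) p.2 := by
  have h : ContDiff ℝ ∞ (fun t => u (p.1, t)) := by fun_prop
  exact (h.differentiable (by simp) p.2).hasDerivAt

lemma pdx_add {u v : ℝ × ℝ → ℝ} (hu : ContDiff ℝ ∞ u) (hv : ContDiff ℝ ∞ v) :
    pdx (u + v) = pdx u + pdx v :=
  funext fun p => ((hu.hasDerivAt_pdx p).add (hv.hasDerivAt_pdx p)).deriv

lemma pdx_sub {u v : ℝ × ℝ → ℝ} (hu : ContDiff ℝ ∞ u) (hv : ContDiff ℝ ∞ v) :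
    pdx (u - v) = pdx u - pdx v :=
  funext fun p => ((hu.hasDerivAt_pdx p).sub (hv.hasDerivAt_pdx p)).deriv

lemma pdx_mul {u v : ℝ × ℝ → ℝ} (hu : ContDiff ℝ ∞ u) (hv : ContDiff ℝ ∞ v) :
    pdx (u * v) = pdx u * v + u * pdx v :=
  funext fun p => ((hu.hasDerivAt_pdx p).mul (hv.hasDerivAt_pdx p)).deriv

lemma pdt_add {u v : ℝ × ℝ → ℝ} (hu : ContDiff ℝ ∞ u) (hv : ContDiff ℝ ∞ v) :
    pdt (u + v) = pdt u + pdt v :=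
  funext fun p => ((hu.hasDerivAt_pdt p).add (hv.hasDerivAt_pdt p)).deriv

lemma pdt_sub {u v : ℝ × ℝ → ℝ} (hu : ContDiff ℝ ∞ u) (hv : ContDiff ℝ ∞ v) :
    pdt (u - v) = pdt u - pdt v :=
  funext fun p => ((hu.hasDerivAt_pdt p).sub (hv.hasDerivAt_pdt p)).deriv

lemma pdt_mul {u v : ℝ × ℝ → ℝ} (hu : ContDiff ℝ ∞ u) (hv : ContDiff ℝ ∞ v) :
    pdt (u * v) = pdt u * v + u * pdt v :=
  funext fun p => ((hu.hasDerivAt_pdt p).mul (hv.hasDerivAt_pdt p)).deriv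

/-- Mixed partial derivatives of a smooth function commute. -/
lemma pdx_pdt_comm {u : ℝ × ℝ → ℝ} (hu : ContDiff ℝ ∞ u) : pdx (pdt u) = pdt (pdx u) := by
  rw [pdx_eq_fderiv hu.pdt, pdt_eq_fderiv hu.pdx]
  funext p
  have hd : DifferentiableAt ℝ (fderiv ℝ u) p :=
    (hu.fderiv_right (m := ∞) (by simp)).differentiable (by simp) p
  have hsymm : IsSymmSndFDerivAt ℝ u p :=
    (contDiff_infty.1 hu 2).contDiffAt.isSymmSndFDerivAt (by simp)
  rw [pdx_eq_fderiv hu, pdt_eq_fderiv hu, fderiv_clm_apply hd (by fun_prop),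
    fderiv_clm_apply hd (by fun_prop)]
  simpa using hsymm.eq (1, 0) (0, 1)

lemma pdx_comp_fst (F : ℝ → ℝ) : pdx (fun p => F p.1) = fun p => deriv F p.1 := rfl

lemma pdt_comp_fst (F : ℝ → ℝ) : pdt (fun p => F p.1) = 0 :=
  funext fun p => deriv_const p.2 (F p.1)

lemma integral_deriv_eq_zero_of_hasCompactSupport {f : ℝ → ℝ} (hf : ContDiff ℝ 1 f)
    (hc : HasCompactSupport f) : ∫ x, deriv f x = 0 :=
  integral_eq_zero_of_hasDerivAt_of_integrable
    (fun x => (hf.differentiable one_ne_zero x).hasDerivAt)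
    ((hf.continuous_deriv le_rfl).integrable_of_hasCompactSupport hc.deriv)
    (hf.continuous.integrable_of_hasCompactSupport hc)

namespace IsTestFun

variable {T : ℝ} {u v : ℝ × ℝ → ℝ}

lemma pdx (hu : IsTestFun T u) : IsTestFun T (pdx u) := by
  refine ⟨hu.1.pdx, ?_⟩
  rw [pdx_eq_fderiv hu.1]
  exact ⟨hu.2.1.fderiv_apply (𝕜 := ℝ) _, (tsupport_fderiv_apply_subset ℝ _).trans hu.2.2⟩

lemma pdt (hu : IsTestFun T u) : IsTestFun T (pdt u) := by
  refine ⟨hu.1.pdt, ?_⟩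
  rw [pdt_eq_fderiv hu.1]
  exact ⟨hu.2.1.fderiv_apply (𝕜 := ℝ) _, (tsupport_fderiv_apply_subset ℝ _).trans hu.2.2⟩

lemma add (hu : IsTestFun T u) (hv : IsTestFun T v) : IsTestFun T (u + v) :=
  ⟨hu.1.add hv.1, hu.2.1.add hv.2.1,
    (tsupport_add u v).trans (union_subset hu.2.2 hv.2.2)⟩

lemma mul_left (hu : IsTestFun T u) (hv : ContDiff ℝ ∞ v) : IsTestFun T (v * u) :=
  ⟨hv.mul hu.1, hu.2.1.mul_left, (tsupport_mul_subset_right).trans hu.2.2⟩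

lemma integrable (hu : IsTestFun T u) : Integrable u :=
  hu.1.continuous.integrable_of_hasCompactSupport hu.2.1

lemma integral_eq (hu : IsTestFun T u) :
    ∫ p, u p = ∫ t, ∫ x, u (x, t) :=
  integral_prod_symm u hu.integrable

lemma setIntegral_eq (hu : IsTestFun T u) :
    ∫ t in Ioo (0 : ℝ) T, ∫ x, u (x, t) = ∫ p, u p := by
  rw [hu.integral_eq]
  refine setIntegral_eq_integral_of_forall_compl_eq_zero fun t ht => ?_
  have h (x : ℝ) : u (x, t) = 0 :=
    image_eq_zero_of_notMem_tsupport fun hx => ht (hu.2.2 hx).2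
  simp [h]

lemma integral_pdx (hu : IsTestFun T u) : ∫ p, _root_.pdx u p = 0 := by
  rw [hu.pdx.integral_eq]
  refine integral_eq_zero_of_ae (.of_forall fun t => ?_)
  have hc : HasCompactSupport (fun x => u (x, t)) :=
    hu.2.1.comp_isClosedEmbedding
      (Function.LeftInverse.isClosedEmbedding (f := Prod.fst) (g := fun x : ℝ => (x, t))
        (fun _ => rfl) continuous_fst (by fun_prop))
  have h1 : ContDiff ℝ 1 (fun x => u (x, t)) := by
    have := hu.1
    fun_prop (disch := simp)
  exact integral_deriv_eq_zero_of_hasCompactSupport h1 hc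

lemma integral_pdt (hu : IsTestFun T u) : ∫ p, _root_.pdt u p = 0 := by
  rw [hu.pdt.integral_eq, integral_integral_swap (f := fun t x => _root_.pdt u (x, t))
    hu.pdt.integrable.swap]
  refine integral_eq_zero_of_ae (.of_forall fun x => ?_)
  have hc : HasCompactSupport (fun t => u (x, t)) :=
    hu.2.1.comp_isClosedEmbedding
      (Function.LeftInverse.isClosedEmbedding (f := Prod.snd) (g := fun t : ℝ => (x, t))
        (fun _ => rfl) continuous_snd (by fun_prop))
  have h1 : ContDiff ℝ 1 (fun t => u (x, t)) := by
    have := hu.1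
    fun_prop (disch := simp)
  exact integral_deriv_eq_zero_of_hasCompactSupport h1 hc

end IsTestFun

/-- Theorem 4 (weak form): for an arbitrary unidirectional shallow water flow,
if the free-surface displacement `η` annihilates the first-variation functional
(with coefficient function `F`) against every test function on `ℝ × (0,T)`, then
`η` satisfies the generalized Camassa–Holm equation
`F'(x) η + η_t + (3η + 2F(x)) η_x − η_txx = 2 η_x η_xx + η η_xxx`. -/
theorem generalizedCamassaHolm_surface_of_weak_arbitraryFlow
    (T : ℝ) (hT : 0 < T) (F : ℝ → ℝ) (hF : ContDiff ℝ (⊤ : ℕ∞) F)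
    (η : ℝ × ℝ → ℝ) (hη : ContDiff ℝ (⊤ : ℕ∞) η)
    (hweak : ∀ ψ : ℝ × ℝ → ℝ, IsTestFun T ψ →
      (∫ t in Ioo (0:ℝ) T, ∫ x : ℝ,
          ((η (x, t) + F x) * (pdt ψ (x, t) + η (x, t) * pdx ψ (x, t) - ψ (x, t) * pdx η (x, t))
            + pdx η (x, t) * (pdx (pdt ψ) (x, t) + η (x, t) * pdx (pdx ψ) (x, t)
                - ψ (x, t) * pdx (pdx η) (x, t)))) = 0) :
    ∀ x : ℝ, ∀ t ∈ Ioo (0:ℝ) T,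
      deriv F x * η (x, t) + pdt η (x, t)
          + (3 * η (x, t) + 2 * F x) * pdx η (x, t)
          - pdx (pdx (pdt η)) (x, t)
        = 2 * pdx η (x, t) * pdx (pdx η) (x, t)
            + η (x, t) * pdx (pdx (pdx η)) (x, t) := by
  set R : ℝ × ℝ → ℝ := fun p =>
    deriv F p.1 * η p + pdt η p + (3 * η p + 2 * F p.1) * pdx η p - pdx (pdx (pdt η)) p
      - 2 * pdx η p * pdx (pdx η) p - η p * pdx (pdx (pdx η)) p with hR_def
  have hη : ContDiff ℝ ∞ η := hη
  have hF1 : ContDiff ℝ ∞ (fun p : ℝ × ℝ => F p.1) := by fun_prop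
  have hF' : ContDiff ℝ ∞ (fun p : ℝ × ℝ => deriv F p.1) := hF1.pdx
  have hx := hη.pdx
  have hxx := hx.pdx
  have hxxx := hxx.pdx
  have ht := hη.pdt
  have htxx := ht.pdx.pdx
  have hR : ContDiff ℝ ∞ R := by fun_prop
  have hcomm : pdx (pdx (pdt η)) = pdt (pdx (pdx η)) := by
    rw [pdx_pdt_comm hη, pdx_pdt_comm hx]
  have key : ∀ ψ : ℝ × ℝ → ℝ, IsTestFun T ψ → ∫ p, R p * ψ p = 0 := by
    intro ψ hψ
    set m : ℝ × ℝ → ℝ := η + fun p => F p.1 with hm_def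
    have hm : ContDiff ℝ ∞ m := hη.add hF1
    have hmx : ContDiff ℝ ∞ (m - pdx (pdx η)) := hm.sub hxx
    have hmη : ContDiff ℝ ∞ (m * η) := hm.mul hη
    have hηx : ContDiff ℝ ∞ (η * pdx η) := hη.mul hx
    have hx2 : ContDiff ℝ ∞ (pdx η * pdx η) := hx.mul hx
    have hηxx : ContDiff ℝ ∞ (η * pdx (pdx η)) := hη.mul hxx
    have hflux : ContDiff ℝ ∞ (m * η - pdx (η * pdx η)) := hmη.sub hηx.pdx
    set A : ℝ × ℝ → ℝ := (m - pdx (pdx η)) * ψ with hA_def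
    set B : ℝ × ℝ → ℝ :=
      (m * η - pdx (η * pdx η)) * ψ + pdx η * pdt ψ + (η * pdx η) * pdx ψ with hB_def
    have hA : IsTestFun T A := hψ.mul_left hmx
    have hB : IsTestFun T B :=
      ((hψ.mul_left hflux).add (hψ.pdt.mul_left hx)).add (hψ.pdx.mul_left hηx)
    have hRψ : IsTestFun T (R * ψ) := hψ.mul_left hR
    have hpA : pdt A = (pdt η - pdt (pdx (pdx η))) * ψ + (m - pdx (pdx η)) * pdt ψ := by
      rw [hA_def, pdt_mul hmx hψ.1, pdt_sub hm hxx, hm_def, pdt_add hη hF1,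
        pdt_comp_fst, add_zero]
    have hpm : pdx m = pdx η + fun p => deriv F p.1 := by
      rw [hm_def, pdx_add hη hF1, pdx_comp_fst]
    have hpB : pdx B =
        (pdx m * η + m * pdx η
          - (pdx (pdx η) * pdx η + pdx η * pdx (pdx η)
            + (pdx η * pdx (pdx η) + η * pdx (pdx (pdx η))))) * ψ
        + (m * η - (pdx η * pdx η + η * pdx (pdx η))) * pdx ψ
        + (pdx (pdx η) * pdt ψ + pdx η * pdx (pdt ψ))
        + ((pdx η * pdx η + η * pdx (pdx η)) * pdx ψ + η * pdx η * pdx (pdx ψ)) := by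
      rw [hB_def, pdx_add ((hψ.mul_left hflux).add (hψ.pdt.mul_left hx)).1 (hψ.pdx.mul_left hηx).1,
        pdx_add (hψ.mul_left hflux).1 (hψ.pdt.mul_left hx).1, pdx_mul hflux hψ.1,
        pdx_mul hx hψ.1.pdt, pdx_mul hηx hψ.1.pdx, pdx_sub hmη hηx.pdx, pdx_mul hm hη,
        pdx_mul hη hx, pdx_add hx2 hηxx, pdx_mul hx hx, pdx_mul hη hxx]
    have hsum : IsTestFun T (pdt A + pdx B - R * ψ) := by
      have := (hA.pdt.add hB.pdx).add (hRψ.mul_left (v := fun _ => -1) contDiff_const)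
      convert this using 1
      funext p
      simp [sub_eq_add_neg]
    have hw := hweak ψ hψ
    have hint : ∫ p, (pdt A + pdx B - R * ψ) p = 0 := by
      rw [← hsum.setIntegral_eq, ← hw]
      congr! 6 with t x
      simp only [hpA, hpB, hpm]
      simp only [hm_def, hR_def, hcomm, Pi.add_apply, Pi.sub_apply, Pi.mul_apply]
      ring
    have hsplit : ∫ p, (pdt A + pdx B - R * ψ) p
        = (∫ p, pdt A p) + (∫ p, pdx B p) - ∫ p, (R * ψ) p := by
      rw [integral_sub' (hA.pdt.add hB.pdx).integrable hRψ.integrable,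
        integral_add' hA.pdt.integrable hB.pdx.integrable]
    rw [hsplit, hA.integral_pdt, hB.integral_pdx] at hint
    simpa using hint
  have hU : IsOpen ((univ : Set ℝ) ×ˢ Ioo 0 T) := isOpen_univ.prod isOpen_Ioo
  have hae : ∀ᵐ p, p ∈ (univ : Set ℝ) ×ˢ Ioo 0 T → R p = 0 :=
    hU.ae_eq_zero_of_integral_contDiff_smul_eq_zero
      (hR.continuous.locallyIntegrable.locallyIntegrableOn _) fun g hg hgc hgs => by
        simpa [mul_comm] using key g ⟨hg, hgc, hgs⟩
  have hzero : EqOn R 0 ((univ : Set ℝ) ×ˢ Ioo 0 T) :=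
    Measure.eqOn_open_of_ae_eq ((ae_restrict_iff' hU.measurableSet).2 hae) hU
      hR.continuous.continuousOn continuousOn_const
  intro x t ht
  have h := hzero (x := (x, t)) ⟨mem_univ x, ht⟩
  simp only [hR_def, Pi.zero_apply] at h
  linarith
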